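/- Uniqueness modulo ≃ for the nominal anti-unification algorithm 𝔑: Let t and s be nominal terms and ∇ a freshness context, all based on the same finite set of atoms A. If {X : t ≜ s}; ∅; ∅; ε ⟹⁺ ∅; S₁; Γ₁; σ₁ and {X : t ≜ s}; ∅; ∅; ε ⟹⁺ ∅; S₂; Γ₂; σ₂ are two maximal derivations in 𝔑 (with global parameters A and ∇), then ⟨Γ₁, Xσ₁⟩ ≃ ⟨Γ₂, Xσ₂⟩. -/

import Mathlib

set_option maxHeartbeats 1000000
abbrev Atom := ℕ
abbrev Var := ℕ
abbrev Fn := ℕ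
abbrev NPerm := List (Atom × Atom)
def swapAtom (a b c : Atom) : Atom := if c = a then b else if c = b then a else c
def permAtom : NPerm → Atom → Atom
  | [], c => c
  | (a, b) :: π, c => swapAtom a b (permAtom π c)
def permInv (π : NPerm) : NPerm := π.reverse
inductive NTerm where
  | app : Fn → List NTerm → NTerm
  | atom : Atom → NTerm
  | abs : Atom → NTerm → NTerm
  | susp : NPerm → Var → NTerm

def permTerm (π : NPerm) : NTerm → NTerm
  | .app f ts => .app f (ts.attach.map (fun x => permTerm π x.1))
  | .atom a => .atom (permAtom π a)
  | .abs a t => .abs (permAtom π a) (permTerm π t)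
  | .susp ρ X => .susp (π ++ ρ) X
decreasing_by
  all_goals (simp_wf; try omega)
  all_goals (have := List.sizeOf_lt_of_mem x.2; omega)

/-- Substitutions (total maps from variables to terms; identity almost everywhere
is not required for the statements). -/
abbrev NSubst := Var → NTerm

def idSubst : NSubst := fun X => .susp [] X

/-- Application of a substitution to a term (allowing atom capture and forcing
suspended permutations). -/
def substTerm (σ : NSubst) : NTerm → NTerm
  | .app f ts => .app f (ts.attach.map (fun x => substTerm σ x.1))
  | .atom a => .atom a
  | .abs a t => .abs a (substTerm σ t)
  | .susp π X => permTerm π (σ X)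
decreasing_by
  all_goals (simp_wf; try omega)
  all_goals (have := List.sizeOf_lt_of_mem x.2; omega)

/-- Composition of substitutions: `t (σθ) = (tσ)θ`. -/
def substComp (σ θ : NSubst) : NSubst := fun X => substTerm θ (σ X)

/-- Freshness contexts: finite sets of constraints `a # X`. -/
abbrev FCtx := Finset (Atom × Var)

/-- The freshness relation `Δ ⊢ a # t` (Urban–Pitts–Gabbay rules), stated for an
arbitrary set of freshness constraints. -/
inductive NFresh (Δ : Set (Atom × Var)) : Atom → NTerm → Prop
  | atom {a b : Atom} : a ≠ b → NFresh Δ a (.atom b)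
  | susp {a : Atom} {π : NPerm} {X : Var} :
      (permAtom (permInv π) a, X) ∈ Δ → NFresh Δ a (.susp π X)
  | app {a : Atom} {f : Fn} {ts : List NTerm} :
      (∀ t ∈ ts, NFresh Δ a t) → NFresh Δ a (.app f ts)
  | abs1 {a : Atom} {t : NTerm} : NFresh Δ a (.abs a t)
  | abs2 {a b : Atom} {t : NTerm} : a ≠ b → NFresh Δ a t → NFresh Δ a (.abs b t)

/-- The α-equivalence relation `Δ ⊢ t ≈ s` (Urban–Pitts–Gabbay rules). -/
inductive NAlpha (Δ : Set (Atom × Var)) : NTerm → NTerm → Prop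
  | atom (a : Atom) : NAlpha Δ (.atom a) (.atom a)
  | abs1 {a : Atom} {t t' : NTerm} : NAlpha Δ t t' → NAlpha Δ (.abs a t) (.abs a t')
  | abs2 {a b : Atom} {t t' : NTerm} : a ≠ b → NAlpha Δ t (permTerm [(a, b)] t') →
      NFresh Δ a t' → NAlpha Δ (.abs a t) (.abs b t')
  | susp {π π' : NPerm} {X : Var} :
      (∀ a : Atom, permAtom π a ≠ permAtom π' a → (a, X) ∈ Δ) →
      NAlpha Δ (.susp π X) (.susp π' X)
  | app {f : Fn} {ts ss : List NTerm} : ts.length = ss.length →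
      (∀ p ∈ List.zip ts ss, NAlpha Δ p.1 p.2) →
      NAlpha Δ (.app f ts) (.app f ss)

/-- `FA⁻ˢ(t)`: atoms occurring freely in `t`, ignoring suspensions. -/
def FAnoSusp : NTerm → Finset Atom
  | .app _ ts => (ts.attach.map (fun x => FAnoSusp x.1)).foldr (· ∪ ·) ∅
  | .atom a => {a}
  | .abs a t => FAnoSusp t \ {a}
  | .susp _ _ => ∅
decreasing_by
  all_goals (simp_wf; try omega)
  all_goals (have := List.sizeOf_lt_of_mem x.2; omega)

/-- A substitution respects a freshness context. -/
def Respects (σ : NSubst) (Δ : FCtx) : Prop :=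
  ∀ a X, (a, X) ∈ Δ → a ∉ FAnoSusp (σ X)

/-! ### The algorithm FC -/

/-- A finite set of atomic freshness formulas `a # t`. -/
abbrev FProb := Multiset (Atom × NTerm)

/-- One step of the algorithm FC, transforming pairs `(F; Δ)`. -/
inductive FCStep : FProb × FCtx → FProb × FCtx → Prop
  | del {a b : Atom} {F : FProb} {Δ : FCtx} : a ≠ b →
      FCStep ((a, .atom b) ::ₘ F, Δ) (F, Δ)
  | abs1 {a : Atom} {t : NTerm} {F : FProb} {Δ : FCtx} :
      FCStep ((a, .abs a t) ::ₘ F, Δ) (F, Δ)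
  | abs2 {a b : Atom} {t : NTerm} {F : FProb} {Δ : FCtx} : a ≠ b →
      FCStep ((a, .abs b t) ::ₘ F, Δ) ((a, t) ::ₘ F, Δ)
  | dec {a : Atom} {f : Fn} {ts : List NTerm} {F : FProb} {Δ : FCtx} :
      FCStep ((a, .app f ts) ::ₘ F, Δ) (↑(ts.map (fun t => (a, t))) + F, Δ)
  | sus {a : Atom} {π : NPerm} {X : Var} {F : FProb} {Δ : FCtx} :
      FCStep ((a, .susp π X) ::ₘ F, Δ) (F, insert (permAtom (permInv π) a, X) Δ)

/-- The algorithm FC succeeds on `F` with result `Γ`. -/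
def FCReaches (F : FProb) (Γ : FCtx) : Prop :=
  Relation.ReflTransGen FCStep (F, ∅) (0, Γ)

/-- The algorithm FC fails on `F` (reaches a stuck state with remaining formulas). -/
def FCFails (F : FProb) : Prop :=
  ∃ st : FProb × FCtx, Relation.ReflTransGen FCStep (F, ∅) st ∧ st.1 ≠ 0 ∧
    ∀ st', ¬ FCStep st st'

/-- The freshness problem `{a # Xσ | a#X ∈ Δ}` defining the instance `Δσ`. -/
def ctxSubstProb (Δ : FCtx) (σ : NSubst) : FProb :=
  Δ.val.map (fun c => (c.1, σ c.2))

/-! ### Terms-in-context and the subsumption order -/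

/-- A term-in-context. -/
abbrev TIC := FCtx × NTerm

/-- `p ⪯ q`: the term-in-context `p` is more general than `q`.  (The condition
`p.1 σ ⊆ q.1` is expressed, equivalently by the properties of FC, as
`q.1 ⊢ a # Xσ` for all `a # X ∈ p.1`.) -/
def TIC.Le (p q : TIC) : Prop :=
  ∃ σ : NSubst, Respects σ p.1 ∧
    (∀ c ∈ p.1, NFresh (↑q.1 : Set (Atom × Var)) c.1 (σ c.2)) ∧
    NAlpha (↑q.1 : Set (Atom × Var)) (substTerm σ p.2) q.2

/-- The strict part of `⪯`. -/
def TIC.Lt (p q : TIC) : Prop := TIC.Le p q ∧ ¬ TIC.Le q p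

/-- Equi-generality `≃`. -/
def TIC.Equiv (p q : TIC) : Prop := TIC.Le p q ∧ TIC.Le q p

/-- `r` is a generalization of `p₁` and `p₂`. -/
def IsGen (r p₁ p₂ : TIC) : Prop := TIC.Le r p₁ ∧ TIC.Le r p₂

/-! ### Atoms, variables, basedness -/

def permAtoms : NPerm → Finset Atom
  | [] => ∅
  | (a, b) :: π => insert a (insert b (permAtoms π))

def termAtoms : NTerm → Finset Atom
  | .app _ ts => (ts.attach.map (fun x => termAtoms x.1)).foldr (· ∪ ·) ∅
  | .atom a => {a}
  | .abs a t => insert a (termAtoms t)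
  | .susp π _ => permAtoms π
decreasing_by
  all_goals (simp_wf; try omega)
  all_goals (have := List.sizeOf_lt_of_mem x.2; omega)

def termVars : NTerm → Finset Var
  | .app _ ts => (ts.attach.map (fun x => termVars x.1)).foldr (· ∪ ·) ∅
  | .atom _ => ∅
  | .abs _ t => termVars t
  | .susp _ X => {X}
decreasing_by
  all_goals (simp_wf; try omega)
  all_goals (have := List.sizeOf_lt_of_mem x.2; omega)

/-- `FA(t)`: the atoms occurring freely in `t` (with `FA(π·X) = Atoms(π)`). -/
def termFA : NTerm → Finset Atom
  | .app _ ts => (ts.attach.map (fun x => termFA x.1)).foldr (· ∪ ·) ∅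
  | .atom a => {a}
  | .abs a t => termFA t \ {a}
  | .susp π _ => permAtoms π
decreasing_by
  all_goals (simp_wf; try omega)
  all_goals (have := List.sizeOf_lt_of_mem x.2; omega)

def ctxAtoms (Δ : FCtx) : Finset Atom := Δ.image Prod.fst
def ctxVars (Δ : FCtx) : Finset Var := Δ.image Prod.snd

def permBased (π : NPerm) (A : Finset Atom) : Prop := permAtoms π ⊆ A
def termBased (t : NTerm) (A : Finset Atom) : Prop := termAtoms t ⊆ A
def ctxBased (Δ : FCtx) (A : Finset Atom) : Prop := ctxAtoms Δ ⊆ A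
def ticBased (p : TIC) (A : Finset Atom) : Prop := ctxBased p.1 A ∧ termBased p.2 A

/-- The number of abstraction occurrences in a term. -/
def absCount : NTerm → ℕ
  | .app _ ts => (ts.attach.map (fun x => absCount x.1)).sum
  | .atom _ => 0
  | .abs _ t => absCount t + 1
  | .susp _ _ => 0
decreasing_by
  all_goals (simp_wf; try omega)
  all_goals (have := List.sizeOf_lt_of_mem x.2; omega)

/-! ### The nominal anti-unification algorithm 𝔑 -/

/-- Anti-unification triple `X : t ≜ s`. -/
abbrev AUT := Var × NTerm × NTerm

/-- A state of the algorithm 𝔑: the unsolved triples `P`, the store `S`, the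
freshness context `Γ`, the substitution `σ`, and the set `V` of variables used
so far (needed to express freshness of the generated variables). -/
structure NState where
  P : Multiset AUT
  S : Multiset AUT
  Γ : FCtx
  σ : NSubst
  V : Finset Var

/-- `σ{X ↦ u}`. -/
def updSubst (σ : NSubst) (X : Var) (u : NTerm) : NSubst :=
  substComp σ (fun Z => if Z = X then u else .susp [] Z)

/-- The head of a term (a function symbol together with its arity, an atom, the
abstraction operator, or a variable). -/
inductive NHead where
  | fn : Fn → ℕ → NHead
  | atom : Atom → NHead
  | abs : NHead
  | var : Var → NHead
deriving DecidableEq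

def headOf : NTerm → NHead
  | .app f ts => .fn f ts.length
  | .atom a => .atom a
  | .abs _ _ => .abs
  | .susp _ X => .var X

def IsSusp : NTerm → Prop
  | .susp _ _ => True
  | _ => False

def IsAbs : NTerm → Prop
  | .abs _ _ => True
  | _ => False

/-- The applicability condition of the rule Sol. -/
def SolCond (A : Finset Atom) (Δ : FCtx) (t s : NTerm) : Prop :=
  headOf t ≠ headOf s ∨ (IsSusp t ∧ IsSusp s) ∨
    (IsAbs t ∧ IsAbs s ∧
      ¬ ∃ c ∈ A, NFresh (↑Δ : Set (Atom × Var)) c t ∧ NFresh (↑Δ : Set (Atom × Var)) c s)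

open Classical in
/-- `{a # X | a ∈ A, Δ ⊢ a # t, Δ ⊢ a # s}`. -/
noncomputable def solSet (A : Finset Atom) (Δ : FCtx) (t s : NTerm) (X : Var) : FCtx :=
  (A.filter (fun a =>
    NFresh (↑Δ : Set (Atom × Var)) a t ∧ NFresh (↑Δ : Set (Atom × Var)) a s)).image
    (fun a => (a, X))

/-- `Γ{Y ↦ π·X}` on a freshness context. -/
def ctxRename (Γ : FCtx) (Y : Var) (π : NPerm) (X : Var) : FCtx :=
  Γ.image (fun c => if c.2 = Y then (permAtom (permInv π) c.1, X) else c)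

/-- One step of the algorithm 𝔑, with global parameters `A` and `Δ`. -/
inductive NStep (A : Finset Atom) (Δ : FCtx) : NState → NState → Prop
  | decApp {X : Var} {f : Fn} {ts ss : List NTerm} {P S : Multiset AUT} {Γ : FCtx}
      {σ : NSubst} {V : Finset Var} (Ys : List Var) :
      ts.length = ss.length → Ys.length = ts.length → Ys.Nodup →
      (∀ Y ∈ Ys, Y ∉ V) →
      NStep A Δ ⟨(X, .app f ts, .app f ss) ::ₘ P, S, Γ, σ, V⟩
        ⟨↑(List.zipWith (fun Y p => (Y, p)) Ys (List.zip ts ss)) + P, S, Γ,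
         updSubst σ X (.app f (Ys.map (fun Y => .susp [] Y))), V ∪ Ys.toFinset⟩
  | decAtom {X : Var} {a : Atom} {P S : Multiset AUT} {Γ : FCtx} {σ : NSubst}
      {V : Finset Var} :
      NStep A Δ ⟨(X, .atom a, .atom a) ::ₘ P, S, Γ, σ, V⟩
        ⟨P, S, Γ, updSubst σ X (.atom a), V⟩
  | abs {X : Var} {a b : Atom} {t s : NTerm} {P S : Multiset AUT} {Γ : FCtx}
      {σ : NSubst} {V : Finset Var} (Y : Var) (c : Atom) :
      Y ∉ V → c ∈ A →
      NFresh (↑Δ : Set (Atom × Var)) c (.abs a t) →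
      NFresh (↑Δ : Set (Atom × Var)) c (.abs b s) →
      NStep A Δ ⟨(X, .abs a t, .abs b s) ::ₘ P, S, Γ, σ, V⟩
        ⟨(Y, permTerm [(c, a)] t, permTerm [(c, b)] s) ::ₘ P, S, Γ,
         updSubst σ X (.abs c (.susp [] Y)), insert Y V⟩
  | sol {X : Var} {t s : NTerm} {P S : Multiset AUT} {Γ : FCtx} {σ : NSubst}
      {V : Finset Var} :
      SolCond A Δ t s →
      NStep A Δ ⟨(X, t, s) ::ₘ P, S, Γ, σ, V⟩
        ⟨P, (X, t, s) ::ₘ S, Γ ∪ solSet A Δ t s X, σ, V⟩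
  | mer {X Y : Var} {t₁ s₁ t₂ s₂ : NTerm} {P S : Multiset AUT} {Γ : FCtx}
      {σ : NSubst} {V : Finset Var} (π : NPerm) :
      X ≠ Y →
      permBased π (termAtoms t₁ ∪ termAtoms s₁ ∪ termAtoms t₂ ∪ termAtoms s₂) →
      NAlpha (↑Δ : Set (Atom × Var)) (permTerm π t₁) t₂ →
      NAlpha (↑Δ : Set (Atom × Var)) (permTerm π s₁) s₂ →
      NStep A Δ ⟨P, (X, t₁, s₁) ::ₘ (Y, t₂, s₂) ::ₘ S, Γ, σ, V⟩
        ⟨P, (X, t₁, s₁) ::ₘ S, ctxRename Γ Y π X, updSubst σ Y (.susp π X), V⟩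

/-- The initial state of 𝔑 on the triple `X : t ≜ s`. -/
def initNState (X : Var) (t s : NTerm) (Δ : FCtx) : NState :=
  ⟨{(X, t, s)}, 0, ∅, idSubst, insert X (termVars t ∪ termVars s ∪ ctxVars Δ)⟩

/-- An `A`-based least general generalization of `p₁` and `p₂`. -/
def IsABasedLgg (A : Finset Atom) (p p₁ p₂ : TIC) : Prop :=
  ticBased p A ∧ IsGen p p₁ p₂ ∧
    ¬ ∃ p' : TIC, ticBased p' A ∧ IsGen p' p₁ p₂ ∧ TIC.Lt p p'

/-! ### The equivariance algorithm 𝔈 -/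

/-- A set of equivariance equations `t ≈ s`. -/
abbrev EProb := Multiset (NTerm × NTerm)

def eqsAtoms (E : EProb) : Finset Atom :=
  (E.map (fun e => termAtoms e.1 ∪ termAtoms e.2)).sup

def eqsVars (E : EProb) : Finset Var :=
  (E.map (fun e => termVars e.1 ∪ termVars e.2)).sup

/-- All equations of `E` are equations between atoms. -/
def AtomEqs (E : EProb) : Prop := ∀ e ∈ E, ∃ a b : Atom, e = (NTerm.atom a, NTerm.atom b)

/-- One step of the equivariance algorithm 𝔈 (with fixed freshness context `Δ`) on
states `(E; A; π)`.  The first-phase rules require `π = Id`; the second-phase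
rules require that only equations between atoms are left. -/
inductive EStep (Δ : FCtx) :
    EProb × Finset Atom × NPerm → EProb × Finset Atom × NPerm → Prop
  | dec {f : Fn} {ts ss : List NTerm} {E : EProb} {A : Finset Atom} :
      ts.length = ss.length →
      EStep Δ ((.app f ts, .app f ss) ::ₘ E, A, []) (↑(List.zip ts ss) + E, A, [])
  | alp {a b : Atom} {t s : NTerm} {E : EProb} {A : Finset Atom} (c : Atom) :
      c ∉ A → c ∉ eqsAtoms ((.abs a t, .abs b s) ::ₘ E) → c ∉ ctxAtoms Δ →
      EStep Δ ((.abs a t, .abs b s) ::ₘ E, A, [])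
        ((permTerm [(c, a)] t, permTerm [(c, b)] s) ::ₘ E, A, [])
  | sus {π₁ π₂ : NPerm} {X : Var} {E : EProb} {A : Finset Atom} :
      EStep Δ ((.susp π₁ X, .susp π₂ X) ::ₘ E, A, [])
        (↑((A.filter (fun a => (a, X) ∉ Δ)).toList.map
            (fun a => (NTerm.atom (permAtom π₁ a), NTerm.atom (permAtom π₂ a)))) + E,
         A, [])
  | rem {a b : Atom} {E : EProb} {A : Finset Atom} {π : NPerm} :
      AtomEqs ((.atom a, .atom b) ::ₘ E) → permAtom π a = b →
      EStep Δ ((.atom a, .atom b) ::ₘ E, A, π) (E, A.erase b, π)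
  | sol {a b : Atom} {E : EProb} {A : Finset Atom} {π : NPerm} :
      AtomEqs ((.atom a, .atom b) ::ₘ E) →
      permAtom π a ∈ A → b ∈ A → permAtom π a ≠ b →
      EStep Δ ((.atom a, .atom b) ::ₘ E, A, π) (E, A.erase b, (permAtom π a, b) :: π)

/-! ### Permutations of atoms -/

theorem swapAtom_swapAtom (a b c : Atom) : swapAtom a b (swapAtom a b c) = c := by
  unfold swapAtom; split_ifs <;> simp_all

theorem permAtom_append (π ρ : NPerm) (x : Atom) :
    permAtom (π ++ ρ) x = permAtom π (permAtom ρ x) := by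
  induction π with
  | nil => rfl
  | cons p π ih => simp [permAtom, ih]

theorem permAtom_permInv_permAtom (π : NPerm) (x : Atom) :
    permAtom (permInv π) (permAtom π x) = x := by
  induction π with
  | nil => rfl
  | cons p π ih =>
    simp only [permInv, List.reverse_cons, permAtom_append] at ih ⊢
    simp [permAtom, swapAtom_swapAtom, ih]

theorem permInv_permInv (π : NPerm) : permInv (permInv π) = π := List.reverse_reverse π

theorem permAtom_permAtom_permInv (π : NPerm) (x : Atom) :
    permAtom π (permAtom (permInv π) x) = x := by
  simpa [permInv_permInv] using permAtom_permInv_permAtom (permInv π) x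

theorem permAtom_injective (π : NPerm) : Function.Injective (permAtom π) :=
  Function.LeftInverse.injective (permAtom_permInv_permAtom π)

theorem permAtoms_append (π ρ : NPerm) : permAtoms (π ++ ρ) = permAtoms π ∪ permAtoms ρ := by
  induction π with
  | nil => simp [permAtoms]
  | cons p π ih => simp [permAtoms, ih]

theorem permAtoms_permInv (π : NPerm) : permAtoms (permInv π) = permAtoms π := by
  induction π with
  | nil => rfl
  | cons p π ih =>
    simp only [permInv, List.reverse_cons, permAtoms_append] at ih ⊢
    ext x
    simp only [ih, permAtoms, Finset.mem_union, Finset.mem_insert, Finset.notMem_empty]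
    tauto

theorem permBased.append {π ρ : NPerm} {A : Finset Atom} (hπ : permBased π A)
    (hρ : permBased ρ A) : permBased (π ++ ρ) A := by
  unfold permBased at *
  rw [permAtoms_append]
  exact Finset.union_subset hπ hρ

theorem permBased.inv {π : NPerm} {A : Finset Atom} (hπ : permBased π A) :
    permBased (permInv π) A := by
  unfold permBased at *
  rwa [permAtoms_permInv]

theorem permBased_cons {a b : Atom} {π : NPerm} {A : Finset Atom} :
    permBased ((a, b) :: π) A ↔ a ∈ A ∧ b ∈ A ∧ permBased π A := by
  simp [permBased, permAtoms, Finset.insert_subset_iff]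

theorem permBased_nil (A : Finset Atom) : permBased [] A := Finset.empty_subset A

theorem permBased.permAtom_mem {π : NPerm} {A : Finset Atom} (hπ : permBased π A) {x : Atom}
    (hx : x ∈ A) : permAtom π x ∈ A := by
  induction π with
  | nil => exact hx
  | cons p π ih =>
    obtain ⟨a, b⟩ := p
    obtain ⟨ha, hb, hπ⟩ := permBased_cons.1 hπ
    have := ih hπ
    simp only [permAtom, swapAtom]
    split_ifs <;> assumption

theorem permBased.permAtom_eq {π : NPerm} {A : Finset Atom} (hπ : permBased π A) {x : Atom}
    (hx : x ∉ A) : permAtom π x = x := by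
  induction π with
  | nil => rfl
  | cons p π ih =>
    obtain ⟨a, b⟩ := p
    obtain ⟨ha, hb, hπ⟩ := permBased_cons.1 hπ
    simp only [permAtom, swapAtom, ih hπ]
    split_ifs with h h'
    · exact absurd (h ▸ ha) hx
    · exact absurd (h' ▸ hb) hx
    · rfl

/-- Every injection agrees, on the atoms of `B` that it keeps inside `B`, with a `B`-based
permutation. -/
theorem exists_permBased_eqOn {f : Atom → Atom} (hf : Function.Injective f) (B : Finset Atom) :
    ∃ π : NPerm, permBased π B ∧ ∀ x ∈ B, f x ∈ B → permAtom π x = f x := by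
  suffices h : ∀ C : Finset Atom, C ⊆ B →
      ∃ π : NPerm, permBased π B ∧ ∀ x ∈ C, f x ∈ B → permAtom π x = f x from h B subset_rfl
  intro C
  induction C using Finset.induction_on with
  | empty => exact fun _ => ⟨[], permBased_nil B, by simp⟩
  | insert x C hx ih =>
    intro hC
    obtain ⟨π, hπ, h⟩ := ih fun y hy => hC (Finset.mem_insert_of_mem hy)
    have hxB := hC (Finset.mem_insert_self x C)
    by_cases hfx : f x ∈ B
    · refine ⟨(permAtom π x, f x) :: π,
        permBased_cons.2 ⟨hπ.permAtom_mem hxB, hfx, hπ⟩, fun z hz hfz => ?_⟩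
      rcases Finset.mem_insert.1 hz with rfl | hz
      · simp [permAtom, swapAtom]
      · have hzx : z ≠ x := fun e => hx (e ▸ hz)
        have h₁ : permAtom π z ≠ permAtom π x := fun e => hzx (permAtom_injective π e)
        have h₂ : permAtom π z ≠ f x := fun e => hzx (hf ((h z hz hfz).symm.trans e))
        rw [permAtom, swapAtom, if_neg h₁, if_neg h₂, h z hz hfz]
    · refine ⟨π, hπ, fun z hz hfz => ?_⟩
      rcases Finset.mem_insert.1 hz with rfl | hz
      · exact absurd hfz hfx
      · exact h z hz hfz

/-! ### Structural lemmas on terms -/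

theorem NTerm.inductionOn {P : NTerm → Prop}
    (app : ∀ f ts, (∀ t ∈ ts, P t) → P (.app f ts)) (atom : ∀ a, P (.atom a))
    (abs : ∀ a t, P t → P (.abs a t)) (susp : ∀ π X, P (.susp π X)) : ∀ t, P t
  | .app f ts => app f ts fun t _ => NTerm.inductionOn app atom abs susp t
  | .atom a => atom a
  | .abs a t => abs a t (NTerm.inductionOn app atom abs susp t)
  | .susp π X => susp π X

theorem permTerm_app (π : NPerm) (f : Fn) (ts : List NTerm) :
    permTerm π (.app f ts) = .app f (ts.map (permTerm π)) := by
  rw [permTerm]; simp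

theorem permTerm_atom (π : NPerm) (a : Atom) :
    permTerm π (.atom a) = .atom (permAtom π a) := by
  rw [permTerm]

theorem permTerm_abs (π : NPerm) (a : Atom) (t : NTerm) :
    permTerm π (.abs a t) = .abs (permAtom π a) (permTerm π t) := by
  rw [permTerm]

theorem permTerm_susp (π ρ : NPerm) (X : Var) :
    permTerm π (.susp ρ X) = .susp (π ++ ρ) X := by
  rw [permTerm]

theorem substTerm_app (σ : NSubst) (f : Fn) (ts : List NTerm) :
    substTerm σ (.app f ts) = .app f (ts.map (substTerm σ)) := by
  rw [substTerm]; simp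

theorem substTerm_atom (σ : NSubst) (a : Atom) : substTerm σ (.atom a) = .atom a := by
  rw [substTerm]

theorem substTerm_abs (σ : NSubst) (a : Atom) (t : NTerm) :
    substTerm σ (.abs a t) = .abs a (substTerm σ t) := by
  rw [substTerm]

theorem substTerm_susp (σ : NSubst) (π : NPerm) (X : Var) :
    substTerm σ (.susp π X) = permTerm π (σ X) := by
  rw [substTerm]

theorem mem_foldr_union {α : Type*} (l : List α) (f : α → Finset Atom) (a : Atom) :
    a ∈ (l.map f).foldr (· ∪ ·) ∅ ↔ ∃ x ∈ l, a ∈ f x := by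
  induction l with
  | nil => simp
  | cons x l ih => simp [ih]

theorem termBased_app {f : Fn} {ts : List NTerm} {A : Finset Atom} :
    termBased (.app f ts) A ↔ ∀ t ∈ ts, termBased t A := by
  unfold termBased
  rw [termAtoms]
  constructor
  · intro h t ht a ha
    exact h ((mem_foldr_union _ _ a).2 ⟨⟨t, ht⟩, List.mem_attach _ _, ha⟩)
  · intro h a ha
    obtain ⟨⟨t, ht⟩, -, hat⟩ := (mem_foldr_union _ _ a).1 ha
    exact h t ht hat

theorem termBased_atom {a : Atom} {A : Finset Atom} : termBased (.atom a) A ↔ a ∈ A := by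
  unfold termBased
  rw [termAtoms]
  simp

theorem termBased_abs {a : Atom} {t : NTerm} {A : Finset Atom} :
    termBased (.abs a t) A ↔ a ∈ A ∧ termBased t A := by
  unfold termBased
  rw [termAtoms, Finset.insert_subset_iff]

theorem termBased_susp {π : NPerm} {X : Var} {A : Finset Atom} :
    termBased (.susp π X) A ↔ permBased π A := by
  unfold termBased permBased
  rw [termAtoms]

theorem termBased.permTerm {π : NPerm} {A : Finset Atom} (hπ : permBased π A) {t : NTerm}
    (ht : termBased t A) : termBased (permTerm π t) A := by
  induction t using NTerm.inductionOn with
  | app f ts ih =>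
    rw [permTerm_app]
    rw [termBased_app] at ht ⊢
    simp only [List.mem_map]
    rintro _ ⟨t, h, rfl⟩
    exact ih t h (ht t h)
  | atom a =>
    rw [permTerm_atom]
    rw [termBased_atom] at ht ⊢
    exact hπ.permAtom_mem ht
  | abs a t ih =>
    rw [permTerm_abs]
    rw [termBased_abs] at ht ⊢
    exact ⟨hπ.permAtom_mem ht.1, ih ht.2⟩
  | susp ρ X =>
    rw [permTerm_susp]
    rw [termBased_susp] at ht ⊢
    exact hπ.append ht

/-! ### α-equivalence along a relation on atoms -/

/-- The extension of a relation on free atoms to the scope of the binders `a` and `b`. -/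
def bindRel (E : Atom → Atom → Prop) (a b : Atom) : Atom → Atom → Prop :=
  fun x y => (x = a ∧ y = b) ∨ (x ≠ a ∧ y ≠ b ∧ E x y)

/-- `AlphaVia D E t s`: under the freshness constraints `D`, the terms `t` and `s` agree up to
bound names when their free atoms are matched by `E`.  For `E` the equality this is
α-equivalence, and freshness and equivariance are other instances. -/
inductive AlphaVia (D : Set (Atom × Var)) : (Atom → Atom → Prop) → NTerm → NTerm → Prop
  | atom {E : Atom → Atom → Prop} {a b : Atom} : E a b → AlphaVia D E (.atom a) (.atom b)
  | susp {E : Atom → Atom → Prop} {π ρ : NPerm} {X : Var} :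
      (∀ a, (a, X) ∉ D → E (permAtom π a) (permAtom ρ a)) →
      AlphaVia D E (.susp π X) (.susp ρ X)
  | app {E : Atom → Atom → Prop} {f : Fn} {ts ss : List NTerm} : ts.length = ss.length →
      (∀ (i : ℕ) (t s : NTerm), ts[i]? = some t → ss[i]? = some s → AlphaVia D E t s) →
      AlphaVia D E (.app f ts) (.app f ss)
  | abs {E : Atom → Atom → Prop} {a b : Atom} {t s : NTerm} :
      AlphaVia D (bindRel E a b) t s → AlphaVia D E (.abs a t) (.abs b s)

namespace AlphaVia

variable {D : Set (Atom × Var)}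

theorem mono {E F : Atom → Atom → Prop} {t s : NTerm} (h : AlphaVia D E t s)
    (hEF : ∀ x y, E x y → F x y) : AlphaVia D F t s := by
  induction h generalizing F with
  | atom h => exact .atom (hEF _ _ h)
  | susp h => exact .susp fun a ha => hEF _ _ (h a ha)
  | app hl _ ih => exact .app hl fun i t s ht hs => ih i t s ht hs hEF
  | abs _ ih =>
    refine .abs (ih fun x y h => ?_)
    exact h.imp_right fun h => ⟨h.1, h.2.1, hEF _ _ h.2.2⟩

theorem symm {E : Atom → Atom → Prop} {t s : NTerm} (h : AlphaVia D E t s) :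
    AlphaVia D (fun x y => E y x) s t := by
  induction h with
  | atom h => exact .atom h
  | susp h => exact .susp h
  | app hl _ ih => exact .app hl.symm fun i t s ht hs => ih i s t hs ht
  | abs _ ih =>
    refine .abs (ih.mono fun x y h => ?_)
    unfold bindRel at *
    tauto

theorem refl {E : Atom → Atom → Prop} (hE : ∀ x, E x x) (t : NTerm) : AlphaVia D E t t := by
  induction t using NTerm.inductionOn generalizing E with
  | app f ts ih =>
    refine .app rfl fun i t s ht hs => ?_
    cases ht.symm.trans hs
    exact ih t (List.mem_of_getElem? ht) hE
  | atom a => exact .atom (hE a)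
  | abs a t ih =>
    refine .abs (ih fun x => ?_)
    by_cases h : x = a
    · exact .inl ⟨h, h⟩
    · exact .inr ⟨h, h, hE x⟩
  | susp π X => exact .susp fun a _ => hE _

theorem comp {E F : Atom → Atom → Prop} {t s u : NTerm} (h : AlphaVia D E t s)
    (h' : AlphaVia D F s u) : AlphaVia D (fun x z => ∃ y, E x y ∧ F y z) t u := by
  induction h generalizing F u with
  | atom h => cases h' with | atom h' => exact .atom ⟨_, h, h'⟩
  | susp h => cases h' with | susp h' => exact .susp fun a ha => ⟨_, h a ha, h' a ha⟩
  | @app E f ts ss hl _ ih =>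
    cases h' with
    | app hl' h' =>
      refine .app (hl.trans hl') fun i t u ht hu => ?_
      have hi : i < ss.length := hl ▸ (List.getElem?_eq_some_iff.1 ht).1
      exact ih i t _ ht (List.getElem?_eq_getElem hi)
        (h' i _ u (List.getElem?_eq_getElem hi) hu)
  | abs _ ih =>
    cases h' with
    | abs h' =>
      refine .abs ((ih h').mono ?_)
      rintro x z ⟨y, ⟨h₁, h₂⟩ | ⟨h₁, h₂, h₃⟩, ⟨h₄, h₅⟩ | ⟨h₄, h₅, h₆⟩⟩
      · exact .inl ⟨h₁, h₅⟩
      · exact absurd h₂ h₄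
      · exact absurd h₄ h₂
      · exact .inr ⟨h₁, h₅, y, h₃, h₆⟩

theorem inter {E F : Atom → Atom → Prop} {t s : NTerm} (h : AlphaVia D E t s)
    (h' : AlphaVia D F t s) : AlphaVia D (fun x y => E x y ∧ F x y) t s := by
  induction h generalizing F with
  | atom h => cases h' with | atom h' => exact .atom ⟨h, h'⟩
  | susp h => cases h' with | susp h' => exact .susp fun a ha => ⟨h a ha, h' a ha⟩
  | app hl _ ih =>
    cases h' with
    | app _ h' => exact .app hl fun i t s ht hs => ih i t s ht hs (h' i t s ht hs)
  | abs _ ih =>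
    cases h' with
    | abs h' =>
      refine .abs ((ih h').mono fun x y h => ?_)
      unfold bindRel at *
      tauto

theorem permTerm_right (π : NPerm) (t : NTerm) :
    AlphaVia D (fun x y => permAtom π x = y) t (permTerm π t) := by
  induction t using NTerm.inductionOn with
  | app f ts ih =>
    rw [permTerm_app]
    refine .app (by simp) fun i t s ht hs => ?_
    simp only [List.getElem?_map, ht, Option.map_some, Option.some.injEq] at hs
    exact hs ▸ ih t (List.mem_of_getElem? ht)
  | atom a => rw [permTerm_atom]; exact .atom rfl
  | abs a t ih =>
    rw [permTerm_abs]
    refine .abs (ih.mono ?_)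
    rintro x _ rfl
    by_cases h : x = a
    · exact .inl ⟨h, h ▸ rfl⟩
    · exact .inr ⟨h, fun e => h (permAtom_injective π e), rfl⟩
  | susp ρ X =>
    rw [permTerm_susp]
    exact .susp fun a _ => (permAtom_append π ρ a).symm

theorem permTerm_left_iff {E : Atom → Atom → Prop} {π : NPerm} {t s : NTerm} :
    AlphaVia D E (permTerm π t) s ↔ AlphaVia D (fun x y => E (permAtom π x) y) t s := by
  constructor <;> intro h
  · exact ((permTerm_right π t).comp h).mono (by rintro x y ⟨_, rfl, h⟩; exact h)
  · exact ((permTerm_right π t).symm.comp h).mono (by rintro x y ⟨_, rfl, h⟩; exact h)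

theorem permTerm_right_iff {E : Atom → Atom → Prop} {π : NPerm} {t s : NTerm} :
    AlphaVia D E t (permTerm π s) ↔ AlphaVia D (fun x y => E x (permAtom π y)) t s :=
  ⟨fun h => (permTerm_left_iff.1 h.symm).symm,
    fun h => (permTerm_left_iff (E := fun y x => E x y).2 h.symm).symm⟩

/-- Atoms that occur in neither term can only be matched with themselves. -/
theorem restrict_based {E : Atom → Atom → Prop} {t s : NTerm} {B : Finset Atom}
    (h : AlphaVia D E t s) (ht : termBased t B) (hs : termBased s B) :
    AlphaVia D (fun x y => E x y ∧ (x ∈ B ∧ y ∈ B ∨ x = y ∧ x ∉ B)) t s := by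
  induction h with
  | atom h => exact .atom ⟨h, .inl ⟨termBased_atom.1 ht, termBased_atom.1 hs⟩⟩
  | susp h =>
    rw [termBased_susp] at ht hs
    refine .susp fun a ha => ⟨h a ha, ?_⟩
    by_cases haB : a ∈ B
    · exact .inl ⟨ht.permAtom_mem haB, hs.permAtom_mem haB⟩
    · rw [ht.permAtom_eq haB, hs.permAtom_eq haB]
      exact .inr ⟨rfl, haB⟩
  | app hl _ ih =>
    rw [termBased_app] at ht hs
    exact .app hl fun i t s hti hsi => ih i t s hti hsi
      (ht t (List.mem_of_getElem? hti)) (hs s (List.mem_of_getElem? hsi))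
  | abs _ ih =>
    refine .abs ((ih (termBased_abs.1 ht).2 (termBased_abs.1 hs).2).mono fun x y h => ?_)
    unfold bindRel at *
    tauto

end AlphaVia

theorem nFresh_iff_alphaVia {D : Set (Atom × Var)} {a : Atom} {t : NTerm} :
    NFresh D a t ↔ AlphaVia D (fun x y => x = y ∧ x ≠ a) t t := by
  induction t using NTerm.inductionOn with
  | app f ts ih =>
    constructor
    · rintro (_ | _ | h | _ | _)
      refine .app rfl fun i t s ht hs => ?_
      cases ht.symm.trans hs
      have hm := List.mem_of_getElem? ht
      exact (ih t hm).1 (h t hm)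
    · rintro (_ | _ | ⟨_, h⟩ | _)
      refine .app fun t ht => ?_
      obtain ⟨i, hi⟩ := List.getElem?_of_mem ht
      exact (ih t ht).2 (h i t t hi hi)
  | atom b =>
    constructor
    · rintro (h | _ | _ | _ | _)
      exact .atom ⟨rfl, h.symm⟩
    · rintro (h | _ | _ | _)
      exact .atom h.2.symm
  | abs b t ih =>
    constructor
    · intro h
      refine .abs ?_
      cases h with
      | abs1 =>
        refine AlphaVia.refl (fun x => ?_) t
        unfold bindRel
        tauto
      | abs2 hab h =>
        refine (ih.1 h).mono fun x y h => ?_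
        unfold bindRel
        obtain ⟨rfl, h⟩ := h
        tauto
    · rintro (_ | _ | _ | h)
      by_cases hab : a = b
      · exact hab ▸ .abs1
      · refine .abs2 hab (ih.2 (h.mono ?_))
        rintro x y (⟨rfl, rfl⟩ | h)
        · exact ⟨rfl, Ne.symm hab⟩
        · exact h.2.2
  | susp π X =>
    constructor
    · rintro (_ | h | _ | _ | _)
      refine .susp fun b hb => ⟨rfl, ?_⟩
      rintro rfl
      rw [permAtom_permInv_permAtom] at h
      exact hb h
    · rintro (_ | h | _ | _)
      refine .susp ?_
      by_contra hn
      exact (h _ hn).2 (permAtom_permAtom_permInv π a)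

namespace AlphaVia

variable {D : Set (Atom × Var)}

theorem restrict_left {E : Atom → Atom → Prop} {t s : NTerm} {a : Atom}
    (h : AlphaVia D E t s) (ha : NFresh D a t) : AlphaVia D (fun x y => E x y ∧ x ≠ a) t s :=
  ((nFresh_iff_alphaVia.1 ha).comp h).mono (by rintro x y ⟨_, ⟨rfl, hx⟩, h⟩; exact ⟨h, hx⟩)

theorem restrict_right {E : Atom → Atom → Prop} {t s : NTerm} {a : Atom}
    (h : AlphaVia D E t s) (ha : NFresh D a s) : AlphaVia D (fun x y => E x y ∧ y ≠ a) t s :=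
  (h.comp (nFresh_iff_alphaVia.1 ha)).mono (by rintro x y ⟨_, h, rfl, hx⟩; exact ⟨h, hx⟩)

theorem perm_inv {π : NPerm} {t s : NTerm} (h : AlphaVia D (fun x y => permAtom π x = y) t s) :
    AlphaVia D (fun x y => permAtom (permInv π) x = y) s t :=
  h.symm.mono (by rintro _ x rfl; exact permAtom_permInv_permAtom π x)

theorem perm_comp {π ρ : NPerm} {t s u : NTerm}
    (h : AlphaVia D (fun x y => permAtom π x = y) t s)
    (h' : AlphaVia D (fun x y => permAtom ρ x = y) s u) :
    AlphaVia D (fun x y => permAtom (ρ ++ π) x = y) t u :=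
  (h.comp h').mono (by rintro x _ ⟨_, rfl, rfl⟩; exact permAtom_append ρ π x)

theorem nFresh_perm {π : NPerm} {t s : NTerm} {a : Atom}
    (h : AlphaVia D (fun x y => permAtom π x = y) t s) (ha : NFresh D a t) :
    NFresh D (permAtom π a) s := by
  have h' := h.restrict_left ha
  refine nFresh_iff_alphaVia.2 ((h'.symm.comp h').mono ?_)
  rintro _ _ ⟨x, ⟨rfl, hx⟩, rfl, -⟩
  exact ⟨rfl, fun e => hx (permAtom_injective π e)⟩

/-- Two permutations that map `t` to `s` differ only on atoms that are fresh for `t`. -/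
theorem nFresh_of_perm_ne {π ρ : NPerm} {t s : NTerm} {a : Atom}
    (h : AlphaVia D (fun x y => permAtom π x = y) t s)
    (h' : AlphaVia D (fun x y => permAtom ρ x = y) t s) (ha : permAtom π a ≠ permAtom ρ a) :
    NFresh D a t := by
  have h'' := h.inter h'
  refine nFresh_iff_alphaVia.2 ((h''.comp h''.symm).mono ?_)
  rintro x y ⟨_, ⟨rfl, hx⟩, hy, -⟩
  exact ⟨permAtom_injective π hy.symm, fun e => ha (e ▸ hx.symm)⟩

end AlphaVia

theorem nAlpha_iff_alphaVia {D : Set (Atom × Var)} {t s : NTerm} :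
    NAlpha D t s ↔ AlphaVia D (fun x y => x = y) t s := by
  constructor
  · intro h
    induction h with
    | atom a => exact .atom rfl
    | abs1 _ ih =>
      refine .abs (ih.mono ?_)
      rintro x _ rfl
      unfold bindRel
      tauto
    | @abs2 a b t t' hab _ hf ih =>
      refine .abs (((AlphaVia.permTerm_right_iff.1 ih).restrict_right hf).mono ?_)
      rintro _ y ⟨rfl, hy⟩
      by_cases hyb : y = b
      · exact .inl ⟨by simp [permAtom, swapAtom, hyb], hyb⟩
      · have e : permAtom [(a, b)] y = y := by simp [permAtom, swapAtom, hy, hyb]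
        exact .inr ⟨by rwa [e], hyb, e⟩
    | susp h =>
      refine .susp fun a ha => ?_
      by_contra hn
      exact ha (h a hn)
    | app hl _ ih =>
      refine .app hl fun i t s ht hs => ih (t, s) ?_
      exact List.mem_of_getElem? (i := i) (List.getElem?_zip_eq_some.2 ⟨ht, hs⟩)
  · intro h
    induction t using NTerm.inductionOn generalizing s with
    | app f ts ih =>
      obtain _ | _ | ⟨hl, h⟩ | _ := h
      refine .app hl ?_
      rintro ⟨t, s⟩ hp
      obtain ⟨i, hi⟩ := List.getElem?_of_mem hp
      obtain ⟨ht, hs⟩ := List.getElem?_zip_eq_some.1 hi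
      exact ih t (List.mem_of_getElem? ht) (h i t s ht hs)
    | atom a =>
      obtain h | _ | _ | _ := h
      exact h ▸ .atom a
    | @abs a t ih =>
      cases h with
      | @abs _ _ b _ s h =>
        by_cases hab : a = b
        · subst hab
          refine .abs1 (ih (h.mono ?_))
          rintro x y (⟨rfl, rfl⟩ | h)
          · rfl
          · exact h.2.2
        · refine .abs2 hab (ih (AlphaVia.permTerm_right_iff.2 (h.mono ?_)))
            (nFresh_iff_alphaVia.2 ((h.symm.comp h).mono ?_))
          · rintro x y (⟨rfl, rfl⟩ | ⟨h₁, h₂, rfl⟩)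
            · simp [permAtom, swapAtom, Ne.symm hab]
            · simp [permAtom, swapAtom, *]
          · rintro y z ⟨x, ⟨rfl, rfl⟩ | ⟨h₁, h₂, rfl⟩, ⟨h₃, rfl⟩ | ⟨h₄, h₅, rfl⟩⟩
            · exact ⟨rfl, Ne.symm hab⟩
            · exact absurd rfl h₄
            · exact absurd h₃ h₁
            · exact ⟨rfl, h₁⟩
    | susp π X =>
      obtain _ | h | _ | _ := h
      refine .susp fun a ha => ?_
      by_contra hn
      exact ha (h a hn)

theorem nAlpha_permTerm_iff {D : Set (Atom × Var)} {π : NPerm} {t s : NTerm} :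
    NAlpha D (permTerm π t) s ↔ AlphaVia D (fun x y => permAtom π x = y) t s :=
  nAlpha_iff_alphaVia.trans AlphaVia.permTerm_left_iff

/-- If some permutation simultaneously maps `t₁` to `t₂` and `s₁` to `s₂`, then so does one
that only uses atoms of these terms. -/
theorem exists_permBased_alphaVia {D : Set (Atom × Var)} {π : NPerm} {t₁ s₁ t₂ s₂ : NTerm}
    (ht : AlphaVia D (fun x y => permAtom π x = y) t₁ t₂)
    (hs : AlphaVia D (fun x y => permAtom π x = y) s₁ s₂) :
    ∃ ρ : NPerm, permBased ρ (termAtoms t₁ ∪ termAtoms s₁ ∪ termAtoms t₂ ∪ termAtoms s₂) ∧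
      AlphaVia D (fun x y => permAtom ρ x = y) t₁ t₂ ∧
      AlphaVia D (fun x y => permAtom ρ x = y) s₁ s₂ := by
  set B := termAtoms t₁ ∪ termAtoms s₁ ∪ termAtoms t₂ ∪ termAtoms s₂ with hB
  obtain ⟨ρ, hρ, hρπ⟩ := exists_permBased_eqOn (permAtom_injective π) B
  have key : ∀ x y, permAtom π x = y ∧ (x ∈ B ∧ y ∈ B ∨ x = y ∧ x ∉ B) →
      permAtom ρ x = y := by
    rintro x _ ⟨rfl, ⟨hx, hy⟩ | ⟨hxy, hx⟩⟩
    · exact hρπ x hx hy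
    · rw [hρ.permAtom_eq hx, ← hxy]
  refine ⟨ρ, hρ, (ht.restrict_based (B := B) ?_ ?_).mono key,
    (hs.restrict_based (B := B) ?_ ?_).mono key⟩ <;>
  · intro a ha
    simp [hB, ha]

/-! ### Freshness and concretion of abstractions -/

theorem nFresh_abs_iff {D : Set (Atom × Var)} {a b : Atom} {t : NTerm} :
    NFresh D a (.abs b t) ↔ (a ≠ b → NFresh D a t) := by
  constructor
  · rintro (_ | _ | _ | _ | ⟨_, h⟩) hab
    · exact absurd rfl hab
    · exact h
  · intro h
    by_cases hab : a = b
    · exact hab ▸ .abs1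
    · exact .abs2 hab (h hab)

theorem nFresh_swap_of_abs {D : Set (Atom × Var)} {a b c : Atom} {t : NTerm} (hac : a ≠ c)
    (ha : NFresh D a (.abs b t)) (hc : NFresh D c (.abs b t)) :
    NFresh D a (permTerm [(c, b)] t) := by
  rw [nFresh_abs_iff] at ha hc
  by_cases hab : a = b
  · subst hab
    simpa [permAtom, swapAtom] using
      (AlphaVia.permTerm_right (D := D) [(c, a)] t).nFresh_perm (hc hac.symm)
  · simpa [permAtom, swapAtom, hac, hab] using
      (AlphaVia.permTerm_right (D := D) [(c, b)] t).nFresh_perm (ha hab)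

theorem AlphaVia.concretion {D : Set (Atom × Var)} {π : NPerm} {a b c d : Atom} {t s : NTerm}
    (h : AlphaVia D (fun x y => permAtom π x = y) (.abs a t) (.abs b s))
    (hc : NFresh D c (.abs a t)) (hd : NFresh D d (.abs b s)) :
    AlphaVia D (fun x y => permAtom ((permAtom π c, d) :: π) x = y)
      (permTerm [(c, a)] t) (permTerm [(d, b)] s) := by
  obtain _ | _ | _ | h := h
  rw [nFresh_abs_iff] at hc hd
  have h₁ : AlphaVia D (fun x y => bindRel (fun x y => permAtom π x = y) a b x y ∧
      (c ≠ a → x ≠ c)) t s := by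
    by_cases hca : c = a
    · exact h.mono fun x y h => ⟨h, fun h => absurd hca h⟩
    · exact (h.restrict_left (hc hca)).mono fun x y h => ⟨h.1, fun _ => h.2⟩
  have h₂ : AlphaVia D (fun x y => (bindRel (fun x y => permAtom π x = y) a b x y ∧
      (c ≠ a → x ≠ c)) ∧ (d ≠ b → y ≠ d)) t s := by
    by_cases hdb : d = b
    · exact h₁.mono fun x y h => ⟨h, fun h => absurd hdb h⟩
    · exact (h₁.restrict_right (hd hdb)).mono fun x y h => ⟨h.1, fun _ => h.2⟩
  rw [AlphaVia.permTerm_left_iff, AlphaVia.permTerm_right_iff]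
  refine h₂.mono ?_
  rintro x y ⟨⟨⟨rfl, rfl⟩ | ⟨hxa, hyb, rfl⟩, hx⟩, hy⟩
  · by_cases hcx : x = c <;> by_cases hdy : y = d <;> simp [permAtom, swapAtom, *]
  · have hxc : x ≠ c := fun e => hx (fun e' => hxa (e.trans e')) e
    have hyd : permAtom π x ≠ d := fun e => hy (fun e' => hyb (e.trans e')) e
    have hne : permAtom π x ≠ permAtom π c := fun e => hxc (permAtom_injective π e)
    simp [permAtom, swapAtom, *]

/-! ### Invariance of the applicability condition of Sol -/

theorem SolCond.of_alphaVia {A : Finset Atom} {Δ : FCtx} {τ : NPerm} (hτ : permBased τ A)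
    {t s t' s' : NTerm} (h : SolCond A Δ t s)
    (ht : AlphaVia (↑Δ) (fun x y => permAtom τ x = y) t t')
    (hs : AlphaVia (↑Δ) (fun x y => permAtom τ x = y) s s') : SolCond A Δ t' s' := by
  rcases h with h | ⟨h₁, h₂⟩ | ⟨h₁, h₂, h₃⟩
  · refine .inl fun e => ?_
    cases ht <;> cases hs <;> simp_all [headOf]
    rename_i h₁ h₂
    exact h (permAtom_injective τ (h₁.trans h₂.symm))
  · refine .inr (.inl ?_)
    cases ht <;> cases hs <;> simp_all [IsSusp]
  · refine .inr (.inr ⟨?_, ?_, ?_⟩)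
    · cases ht <;> simp_all [IsAbs]
    · cases hs <;> simp_all [IsAbs]
    · rintro ⟨c, hc, hct, hcs⟩
      exact h₃ ⟨_, hτ.inv.permAtom_mem hc, ht.perm_inv.nFresh_perm hct,
        hs.perm_inv.nFresh_perm hcs⟩

theorem not_solCond_atom {A : Finset Atom} {Δ : FCtx} {a : Atom} :
    ¬ SolCond A Δ (.atom a) (.atom a) := by
  simp [SolCond, IsSusp, IsAbs]

theorem not_solCond_app {A : Finset Atom} {Δ : FCtx} {f : Fn} {ts ss : List NTerm}
    (h : ts.length = ss.length) : ¬ SolCond A Δ (.app f ts) (.app f ss) := by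
  simp [SolCond, IsSusp, IsAbs, headOf, h]

theorem not_solCond_abs {A : Finset Atom} {Δ : FCtx} {a b c : Atom} {t s : NTerm} (hc : c ∈ A)
    (ht : NFresh (↑Δ) c (.abs a t)) (hs : NFresh (↑Δ) c (.abs b s)) :
    ¬ SolCond A Δ (.abs a t) (.abs b s) := by
  rintro (h | h | h)
  · exact h rfl
  · exact h.1
  · exact h.2.2 ⟨c, hc, ht, hs⟩

/-! ### Generalizations computed by 𝔑 -/

/-- `Generalizes A Δ L r t s`: the term `r` arises from decomposing the pair `t`, `s` along the
rules Dec and Abs, where the suspensions of `r` are related to pairs of subterms by `L`. -/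
inductive Generalizes (A : Finset Atom) (Δ : FCtx) (L : NPerm → Var → NTerm → NTerm → Prop) :
    NTerm → NTerm → NTerm → Prop
  | leaf {π : NPerm} {Z : Var} {t s : NTerm} : L π Z t s → Generalizes A Δ L (.susp π Z) t s
  | atom (a : Atom) : Generalizes A Δ L (.atom a) (.atom a) (.atom a)
  | app {f : Fn} {rs ts ss : List NTerm} : rs.length = ts.length → ts.length = ss.length →
      (∀ (i : ℕ) (r t s : NTerm), rs[i]? = some r → ts[i]? = some t → ss[i]? = some s →
        Generalizes A Δ L r t s) →
      Generalizes A Δ L (.app f rs) (.app f ts) (.app f ss)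
  | abs {a b c : Atom} {r t s : NTerm} : c ∈ A → NFresh (↑Δ) c (.abs a t) →
      NFresh (↑Δ) c (.abs b s) →
      Generalizes A Δ L r (permTerm [(c, a)] t) (permTerm [(c, b)] s) →
      Generalizes A Δ L (.abs c r) (.abs a t) (.abs b s)

theorem Generalizes.subst {A : Finset Atom} {Δ : FCtx}
    {L L' : NPerm → Var → NTerm → NTerm → Prop} {θ : NSubst} {r t s : NTerm}
    (h : Generalizes A Δ L r t s)
    (hL : ∀ π Z t s, L π Z t s → Generalizes A Δ L' (permTerm π (θ Z)) t s) :
    Generalizes A Δ L' (substTerm θ r) t s := by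
  induction h with
  | leaf h => rw [substTerm_susp]; exact hL _ _ _ _ h
  | atom a => rw [substTerm_atom]; exact .atom a
  | app h₁ h₂ _ ih =>
    rw [substTerm_app]
    refine .app (by simpa using h₁) h₂ fun i r t s hr ht hs => ?_
    rw [List.getElem?_map, Option.map_eq_some_iff] at hr
    obtain ⟨r, hr, rfl⟩ := hr
    exact ih i r t s hr ht hs
  | abs hc ht hs _ ih => rw [substTerm_abs]; exact .abs hc ht hs ih

theorem Generalizes.mono {A : Finset Atom} {Δ : FCtx}
    {L L' : NPerm → Var → NTerm → NTerm → Prop} {r t s : NTerm}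
    (h : Generalizes A Δ L r t s) (hL : ∀ π Z t s, L π Z t s → L' π Z t s) :
    Generalizes A Δ L' r t s := by
  induction h with
  | leaf h => exact .leaf (hL _ _ _ _ h)
  | atom a => exact .atom a
  | app h₁ h₂ _ ih => exact .app h₁ h₂ ih
  | abs hc ht hs _ ih => exact .abs hc ht hs ih

/-- The suspension `π·Z` generalizes `t` and `s` by means of a triple for `Z` in the store `S`. -/
def StoreLeaf (A : Finset Atom) (Δ : FCtx) (S : Multiset AUT) (π : NPerm) (Z : Var)
    (t s : NTerm) : Prop :=
  SolCond A Δ t s ∧ permBased π A ∧ ∃ t₀ s₀, (Z, t₀, s₀) ∈ S ∧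
    AlphaVia (↑Δ) (fun x y => permAtom π x = y) t₀ t ∧
    AlphaVia (↑Δ) (fun x y => permAtom π x = y) s₀ s

/-- The suspension `π·Z` stands for an unsolved triple or for an instance of a stored one. -/
def StateLeaf (A : Finset Atom) (Δ : FCtx) (P S : Multiset AUT) (π : NPerm) (Z : Var)
    (t s : NTerm) : Prop :=
  (π = [] ∧ (Z, t, s) ∈ P) ∨ StoreLeaf A Δ S π Z t s

/-- The freshness context `Γ` consists of the constraints `solSet` of the stored triples. -/
def CtxOfStore (A : Finset Atom) (Δ : FCtx) (S : Multiset AUT) (Γ : FCtx) : Prop :=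
  ∀ a Z, (a, Z) ∈ Γ ↔
    ∃ t s, (Z, t, s) ∈ S ∧ a ∈ A ∧ NFresh (↑Δ) a t ∧ NFresh (↑Δ) a s

/-- The invariant of the derivations of 𝔑 from the triple `X : t ≜ s`. -/
structure NInvariant (A : Finset Atom) (Δ : FCtx) (X : Var) (t s : NTerm) (st : NState) :
    Prop where
  nodup : ((st.P + st.S).map Prod.fst).Nodup
  mem_vars : ∀ p ∈ st.P + st.S, p.1 ∈ st.V
  based : ∀ p ∈ st.P + st.S, termBased p.2.1 A ∧ termBased p.2.2 A
  ctx : CtxOfStore A Δ st.S st.Γ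
  generalizes : Generalizes A Δ (StateLeaf A Δ st.P st.S) (st.σ X) t s

theorem nInvariant_init {A : Finset Atom} {Δ : FCtx} {X : Var} {t s : NTerm}
    (ht : termBased t A) (hs : termBased s A) :
    NInvariant A Δ X t s (initNState X t s Δ) where
  nodup := by simp [initNState]
  mem_vars := by simp [initNState]
  based := by simp [initNState, ht, hs]
  ctx := by simp [CtxOfStore, initNState]
  generalizes := .leaf (.inl ⟨rfl, by simp [initNState]⟩)

theorem mem_ctxRename {Γ : FCtx} {X Y Z : Var} {π : NPerm} {a : Atom} :
    (a, Z) ∈ ctxRename Γ Y π X ↔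
      (Z = X ∧ (permAtom π a, Y) ∈ Γ) ∨ (Z ≠ Y ∧ (a, Z) ∈ Γ) := by
  simp only [ctxRename, Finset.mem_image, Prod.exists]
  constructor
  · rintro ⟨b, W, h, e⟩
    split_ifs at e with hW
    · cases e
      subst hW
      exact .inl ⟨rfl, by rwa [permAtom_permAtom_permInv]⟩
    · cases e
      exact .inr ⟨hW, h⟩
  · rintro (⟨rfl, h⟩ | ⟨hZ, h⟩)
    · exact ⟨_, _, h, by simp [permAtom_permInv_permAtom]⟩
    · exact ⟨a, Z, h, by simp [hZ]⟩

/-- A substitution step that only replaces the variable `X` preserves generalization, as soon as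
the leaves for `X` and the leaves for other variables remain justified. -/
theorem Generalizes.updSubst {A : Finset Atom} {Δ : FCtx}
    {L L' : NPerm → Var → NTerm → NTerm → Prop} {σ : NSubst} {X Y : Var} {u t s : NTerm}
    (h : Generalizes A Δ L (σ X) t s)
    (hY : ∀ π t s, L π Y t s → Generalizes A Δ L' (permTerm π u) t s)
    (hL : ∀ π Z t s, Z ≠ Y → L π Z t s → L' π Z t s) :
    Generalizes A Δ L' (updSubst σ Y u X) t s := by
  refine h.subst fun π Z t s hZ => ?_
  by_cases e : Z = Y
  · subst e
    simpa using hY π t s hZ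
  · simp only [if_neg e, permTerm_susp, List.append_nil]
    exact .leaf (hL π Z t s e hZ)

theorem NInvariant.step {A : Finset Atom} {Δ : FCtx} {X : Var} {t s : NTerm} {st st' : NState}
    (h : NInvariant A Δ X t s st) (hst : NStep A Δ st st') : NInvariant A Δ X t s st' := by
  obtain ⟨hnd, hV, hA, hΓ, hg⟩ := h
  cases hst with
  | @decApp Y f ts ss P S Γ σ V Ys hl hlY hYs hYV =>
    simp only [Multiset.cons_add, Multiset.map_cons, Multiset.nodup_cons] at hnd
    have hfst : (List.zipWith (fun Y p => (Y, p)) Ys (List.zip ts ss)).map Prod.fst = Ys := by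
      apply List.map_fst_zip
      simp [hlY, hl]
    have hmem : ∀ p ∈ List.zipWith (fun Y p => (Y, p)) Ys (List.zip ts ss),
        p.1 ∈ Ys ∧ p.2.1 ∈ ts ∧ p.2.2 ∈ ss := by
      intro p hp
      have hp' : (p.1, p.2) ∈ List.zip Ys (List.zip ts ss) := hp
      exact ⟨(List.of_mem_zip hp').1, List.of_mem_zip (List.of_mem_zip hp').2⟩
    have hYA := hA (Y, .app f ts, .app f ss) (by simp)
    simp only [termBased_app] at hYA
    refine ⟨?_, ?_, ?_, hΓ, ?_⟩
    · simp only [add_assoc, Multiset.map_add, Multiset.map_coe, hfst]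
      rw [← Multiset.map_add]
      refine Multiset.nodup_add.2 ⟨Multiset.coe_nodup.2 hYs, hnd.2, ?_⟩
      rw [Multiset.disjoint_left]
      intro Z hZ hZ'
      obtain ⟨p, hp, rfl⟩ := Multiset.mem_map.1 hZ'
      exact hYV _ (Multiset.mem_coe.1 hZ) (hV p (by simp [hp]))
    · intro p hp
      simp only [add_assoc] at hp
      rcases Multiset.mem_add.1 hp with hp | hp
      · simp [(hmem p (Multiset.mem_coe.1 hp)).1]
      · exact Finset.mem_union_left _ (hV p (by simp only [Multiset.cons_add]; simp [hp]))
    · intro p hp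
      simp only [add_assoc] at hp
      rcases Multiset.mem_add.1 hp with hp | hp
      · have := hmem p (Multiset.mem_coe.1 hp)
        exact ⟨hYA.1 _ this.2.1, hYA.2 _ this.2.2⟩
      · exact hA p (by simp only [Multiset.cons_add]; simp [hp])
    · refine hg.updSubst ?_ ?_
      · rintro π t s (⟨rfl, h⟩ | ⟨-, -, t₀, s₀, h, -⟩)
        · rcases Multiset.mem_cons.1 h with h | h
          · cases h
            rw [permTerm_app]
            refine .app (by simp [hlY]) hl fun i r t s hr ht hs => ?_
            simp only [List.getElem?_map, Option.map_eq_some_iff] at hr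
            obtain ⟨_, ⟨Z, hZ, rfl⟩, rfl⟩ := hr
            rw [permTerm_susp]
            refine .leaf (.inl ⟨rfl, Multiset.mem_add.2 (.inl (Multiset.mem_coe.2 ?_))⟩)
            refine List.mem_of_getElem? (i := i) ?_
            exact List.getElem?_zip_eq_some.2 ⟨hZ, List.getElem?_zip_eq_some.2 ⟨ht, hs⟩⟩
          · exact absurd (Multiset.mem_map_of_mem Prod.fst (Multiset.mem_add.2 (.inl h))) hnd.1
        · exact absurd (Multiset.mem_map_of_mem Prod.fst (Multiset.mem_add.2 (.inr h))) hnd.1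
      · rintro π Z t s hZ (⟨rfl, h⟩ | h)
        · rcases Multiset.mem_cons.1 h with h | h
          · cases h
            exact absurd rfl hZ
          · exact .inl ⟨rfl, Multiset.mem_add.2 (.inr h)⟩
        · exact .inr h
  | @decAtom Y a P S Γ σ V =>
    simp only [Multiset.cons_add, Multiset.map_cons, Multiset.nodup_cons] at hnd
    refine ⟨hnd.2, fun p hp => hV p ?_, fun p hp => hA p ?_, hΓ, hg.updSubst ?_ ?_⟩
    · simp only [Multiset.cons_add]; exact Multiset.mem_cons_of_mem hp
    · simp only [Multiset.cons_add]; exact Multiset.mem_cons_of_mem hp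
    · rintro π t s (⟨rfl, h⟩ | ⟨-, -, t₀, s₀, h, -⟩)
      · rcases Multiset.mem_cons.1 h with h | h
        · cases h
          rw [permTerm_atom]
          exact .atom a
        · exact absurd (Multiset.mem_map_of_mem Prod.fst (Multiset.mem_add.2 (.inl h))) hnd.1
      · exact absurd (Multiset.mem_map_of_mem Prod.fst (Multiset.mem_add.2 (.inr h))) hnd.1
    · rintro π Z t s hZ (⟨rfl, h⟩ | h)
      · rcases Multiset.mem_cons.1 h with h | h
        · cases h
          exact absurd rfl hZ
        · exact .inl ⟨rfl, h⟩
      · exact .inr h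
  | @abs Y a b t' s' P S Γ σ V Y' c hY' hc hct hcs =>
    simp only [Multiset.cons_add, Multiset.map_cons, Multiset.nodup_cons] at hnd
    have hYA := hA (Y, .abs a t', .abs b s') (by simp)
    simp only [termBased_abs] at hYA
    refine ⟨?_, ?_, ?_, hΓ, hg.updSubst ?_ ?_⟩
    · simp only [Multiset.cons_add, Multiset.map_cons, Multiset.nodup_cons]
      refine ⟨fun hm => ?_, hnd.2⟩
      obtain ⟨p, hp, rfl⟩ := Multiset.mem_map.1 hm
      exact hY' (hV p (by simp only [Multiset.cons_add]; exact Multiset.mem_cons_of_mem hp))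
    · intro p hp
      simp only [Multiset.cons_add] at hp
      rcases Multiset.mem_cons.1 hp with rfl | hp
      · simp
      · exact Finset.mem_insert_of_mem
          (hV p (by simp only [Multiset.cons_add]; exact Multiset.mem_cons_of_mem hp))
    · intro p hp
      simp only [Multiset.cons_add] at hp
      rcases Multiset.mem_cons.1 hp with rfl | hp
      · exact ⟨hYA.1.2.permTerm (permBased_cons.2 ⟨hc, hYA.1.1, permBased_nil A⟩),
          hYA.2.2.permTerm (permBased_cons.2 ⟨hc, hYA.2.1, permBased_nil A⟩)⟩
      · exact hA p (by simp only [Multiset.cons_add]; exact Multiset.mem_cons_of_mem hp)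
    · rintro π t s (⟨rfl, h⟩ | ⟨-, -, t₀, s₀, h, -⟩)
      · rcases Multiset.mem_cons.1 h with h | h
        · cases h
          rw [permTerm_abs, permTerm_susp]
          exact .abs hc hct hcs (.leaf (.inl ⟨rfl, Multiset.mem_cons_self _ _⟩))
        · exact absurd (Multiset.mem_map_of_mem Prod.fst (Multiset.mem_add.2 (.inl h))) hnd.1
      · exact absurd (Multiset.mem_map_of_mem Prod.fst (Multiset.mem_add.2 (.inr h))) hnd.1
    · rintro π Z t s hZ (⟨rfl, h⟩ | h)
      · rcases Multiset.mem_cons.1 h with h | h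
        · cases h
          exact absurd rfl hZ
        · exact .inl ⟨rfl, Multiset.mem_cons_of_mem h⟩
      · exact .inr h
  | @sol Y t' s' P S Γ σ V hsol =>
    have hPS : P + (Y, t', s') ::ₘ S = (Y, t', s') ::ₘ P + S := by
      rw [Multiset.add_cons, Multiset.cons_add]
    refine ⟨hPS ▸ hnd, hPS ▸ hV, hPS ▸ hA, ?_, hg.mono ?_⟩
    · intro a Z
      have := hΓ a Z
      simp only [Finset.mem_union, solSet, Finset.mem_image, Finset.mem_filter, Prod.mk.injEq,
        Multiset.mem_cons, this]
      constructor
      · rintro (⟨t, s, hm, h⟩ | ⟨b, ⟨hb, h⟩, rfl, rfl⟩)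
        · exact ⟨t, s, .inr hm, h⟩
        · exact ⟨t', s', .inl ⟨rfl, rfl, rfl⟩, hb, h⟩
      · rintro ⟨t, s, ⟨rfl, rfl, rfl⟩ | hm, hb, h⟩
        · exact .inr ⟨a, ⟨hb, h⟩, rfl, rfl⟩
        · exact .inl ⟨t, s, hm, hb, h⟩
    · rintro π Z t s (⟨rfl, h⟩ | ⟨h, hπ, t₀, s₀, hm, h'⟩)
      · rcases Multiset.mem_cons.1 h with h | h
        · cases h
          exact .inr ⟨hsol, permBased_nil A, t', s', Multiset.mem_cons_self _ _,
            AlphaVia.refl (fun _ => rfl) _, AlphaVia.refl (fun _ => rfl) _⟩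
        · exact .inl ⟨rfl, h⟩
      · exact .inr ⟨h, hπ, t₀, s₀, Multiset.mem_cons_of_mem hm, h'⟩
  | @mer Y W t₁ s₁ t₂ s₂ P S Γ σ V π hYW hπ ht hs =>
    rw [nAlpha_permTerm_iff] at ht hs
    have hPS : P + (Y, t₁, s₁) ::ₘ (W, t₂, s₂) ::ₘ S =
        (W, t₂, s₂) ::ₘ (P + (Y, t₁, s₁) ::ₘ S) := by
      rw [Multiset.cons_swap, Multiset.add_cons]
    simp only [hPS] at hnd hV hA
    simp only [Multiset.map_cons, Multiset.nodup_cons] at hnd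
    have hπA : permBased π A := by
      have h₁ := hA (Y, t₁, s₁) (by simp)
      have h₂ := hA (W, t₂, s₂) (by simp)
      exact hπ.trans (Finset.union_subset (Finset.union_subset
        (Finset.union_subset h₁.1 h₁.2) h₂.1) h₂.2)
    have hW : ∀ t s, (W, t, s) ∈ (Y, t₁, s₁) ::ₘ (W, t₂, s₂) ::ₘ S → t = t₂ ∧ s = s₂ := by
      intro t s h
      rw [Multiset.cons_swap] at h
      rcases Multiset.mem_cons.1 h with h | h
      · cases h
        exact ⟨rfl, rfl⟩
      · exact absurd (Multiset.mem_map_of_mem Prod.fst (Multiset.mem_add.2 (.inr h))) hnd.1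
    have hne : ∀ Z t s, Z ≠ W → (Z, t, s) ∈ (Y, t₁, s₁) ::ₘ (W, t₂, s₂) ::ₘ S →
        (Z, t, s) ∈ (Y, t₁, s₁) ::ₘ S := by
      intro Z t s hZ h
      rw [Multiset.cons_swap] at h
      rcases Multiset.mem_cons.1 h with h | h
      · cases h
        exact absurd rfl hZ
      · exact h
    refine ⟨hnd.2, fun p hp => hV p (Multiset.mem_cons_of_mem hp),
      fun p hp => hA p (Multiset.mem_cons_of_mem hp), ?_, hg.updSubst ?_ ?_⟩
    · intro a Z
      simp only [mem_ctxRename, hΓ a Z, hΓ (permAtom π a) W]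
      constructor
      · rintro (⟨rfl, t, s, hm, ha, hat, has⟩ | ⟨hZ, t, s, hm, h⟩)
        · obtain ⟨rfl, rfl⟩ := hW t s hm
          rw [← permAtom_permInv_permAtom π a]
          exact ⟨t₁, s₁, Multiset.mem_cons_self _ _, hπA.inv.permAtom_mem ha,
            ht.perm_inv.nFresh_perm hat, hs.perm_inv.nFresh_perm has⟩
        · exact ⟨t, s, hne Z t s hZ hm, h⟩
      · rintro ⟨t, s, hm, h⟩
        have hZ : Z ≠ W := by
          rintro rfl
          exact hnd.1 (Multiset.mem_map_of_mem Prod.fst (Multiset.mem_add.2 (.inr hm)))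
        refine .inr ⟨hZ, t, s, ?_, h⟩
        rw [Multiset.cons_swap]
        exact Multiset.mem_cons_of_mem hm
    · rintro ρ t s (⟨rfl, h⟩ | ⟨h, hρ, t₀, s₀, hm, h₁, h₂⟩)
      · exact absurd (Multiset.mem_map_of_mem Prod.fst (Multiset.mem_add.2 (.inl h))) hnd.1
      · obtain ⟨rfl, rfl⟩ := hW _ _ hm
        rw [permTerm_susp]
        exact .leaf (.inr ⟨h, hρ.append hπA, t₁, s₁, Multiset.mem_cons_self _ _,
          ht.perm_comp h₁, hs.perm_comp h₂⟩)
    · rintro ρ Z t s hZ (h | ⟨h, hρ, t₀, s₀, hm, h₁₂⟩)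
      · exact .inl h
      · exact .inr ⟨h, hρ, t₀, s₀, hne _ _ _ hZ hm, h₁₂⟩

/-! ### Comparison of two generalizations of the same pair -/

theorem Generalizes.nFresh {A : Finset Atom} {Δ Γ : FCtx} {S : Multiset AUT}
    (hΓ : CtxOfStore A Δ S Γ) {r t s : NTerm} (h : Generalizes A Δ (StoreLeaf A Δ S) r t s)
    {a : Atom} (ha : a ∈ A) (ht : NFresh (↑Δ) a t) (hs : NFresh (↑Δ) a s) :
    NFresh (↑Γ) a r := by
  induction h with
  | leaf h =>
    obtain ⟨-, hπ, t₀, s₀, hm, h₁, h₂⟩ := h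
    exact .susp (Finset.mem_coe.2 ((hΓ _ _).2 ⟨t₀, s₀, hm, hπ.inv.permAtom_mem ha,
      h₁.perm_inv.nFresh_perm ht, h₂.perm_inv.nFresh_perm hs⟩))
  | atom b =>
    obtain h | _ | _ | _ | _ := ht
    exact .atom h
  | @app f rs ts ss h₁ h₂ _ ih =>
    obtain _ | _ | ht | _ | _ := ht
    obtain _ | _ | hs | _ | _ := hs
    refine .app fun r hr => ?_
    obtain ⟨i, hi⟩ := List.getElem?_of_mem hr
    have hit : i < ts.length := h₁ ▸ (List.getElem?_eq_some_iff.1 hi).1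
    have his : i < ss.length := h₂ ▸ hit
    exact ih i r _ _ hi (List.getElem?_eq_getElem hit) (List.getElem?_eq_getElem his)
      (ht _ (List.getElem_mem hit)) (hs _ (List.getElem_mem his))
  | @abs b b' c r t s hc hct hcs _ ih =>
    by_cases hac : a = c
    · exact hac ▸ .abs1
    · exact .abs2 hac (ih (nFresh_swap_of_abs hac ht hct) (nFresh_swap_of_abs hac hs hcs))

/-- The `A`-based permutation `ρ` maps a triple for `Z'` in `S'` to a triple for `Z` in `S`. -/
def StoreMatch (A : Finset Atom) (Δ : FCtx) (S S' : Multiset AUT) (Z : Var) (ρ : NPerm)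
    (Z' : Var) : Prop :=
  permBased ρ A ∧ ∃ t s t₁ s₁, (Z, t, s) ∈ S ∧ (Z', t₁, s₁) ∈ S' ∧
    AlphaVia (↑Δ) (fun x y => permAtom ρ x = y) t₁ t ∧
    AlphaVia (↑Δ) (fun x y => permAtom ρ x = y) s₁ s

/-- The generalization variables in a store are determined by their triples up to a permutation:
no two different triples can be merged. -/
def StoreReduced (Δ : FCtx) (S : Multiset AUT) : Prop :=
  ∀ Z t s Z' t' s' π, (Z, t, s) ∈ S → (Z', t', s') ∈ S →
    AlphaVia (↑Δ) (fun x y => permAtom π x = y) t t' →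
    AlphaVia (↑Δ) (fun x y => permAtom π x = y) s s' → Z = Z'

theorem storeReduced_of_maximal {A : Finset Atom} {Δ : FCtx} {st : NState}
    (h : ∀ st', ¬ NStep A Δ st st') : StoreReduced Δ st.S := by
  intro Z t s Z' t' s' π hZ hZ' ht hs
  by_contra hne
  obtain ⟨ρ, hρ, ht, hs⟩ := exists_permBased_alphaVia ht hs
  obtain ⟨S₁, hS₁⟩ := Multiset.exists_cons_of_mem hZ
  rw [hS₁] at hZ'
  have hZ'' : (Z', t', s') ∈ S₁ := by
    rcases Multiset.mem_cons.1 hZ' with e | e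
    · cases e
      exact absurd rfl hne
    · exact e
  obtain ⟨S₂, rfl⟩ := Multiset.exists_cons_of_mem hZ''
  obtain ⟨P, S, Γ, σ, V⟩ := st
  obtain rfl : S = _ := hS₁
  exact h _ (.mer ρ hne hρ (nAlpha_permTerm_iff.2 ht) (nAlpha_permTerm_iff.2 hs))

theorem Generalizes.alphaVia_substTerm {A : Finset Atom} {Δ Γ' : FCtx} {S S' : Multiset AUT}
    (hS : (S.map Prod.fst).Nodup) (hS' : (S'.map Prod.fst).Nodup)
    (hΓ' : CtxOfStore A Δ S' Γ') (hred : StoreReduced Δ S') {σ : NSubst}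
    (hσ : ∀ Z, (∃ ρ Z', StoreMatch A Δ S S' Z ρ Z') →
      ∃ ρ Z', σ Z = .susp ρ Z' ∧ StoreMatch A Δ S S' Z ρ Z')
    {r r' t t' s s' : NTerm} {τ : NPerm}
    (h : Generalizes A Δ (StoreLeaf A Δ S) r t s)
    (h' : Generalizes A Δ (StoreLeaf A Δ S') r' t' s') (hτ : permBased τ A)
    (ht : AlphaVia (↑Δ) (fun x y => permAtom τ x = y) t t')
    (hs : AlphaVia (↑Δ) (fun x y => permAtom τ x = y) s s') :
    AlphaVia (↑Γ') (fun x y => permAtom τ x = y) (substTerm σ r) r' := by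
  induction h generalizing r' t' s' τ with
  | @leaf π Z t s h =>
    obtain ⟨hsol, hπ, t₀, s₀, hm, h₁, h₂⟩ := h
    have hsol' := hsol.of_alphaVia hτ ht hs
    cases h' with
    | atom => exact absurd hsol' not_solCond_atom
    | app _ hl => exact absurd hsol' (not_solCond_app hl)
    | abs hc hct hcs => exact absurd hsol' (not_solCond_abs hc hct hcs)
    | @leaf π' Z' _ _ h' =>
      obtain ⟨-, hπ', t₁, s₁, hm', h₁', h₂'⟩ := h'
      obtain ⟨ρ, W, hW, hρ, t₂, s₂, t₃, s₃, hm₂, hm₃, h₃, h₄⟩ := hσ Z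
        ⟨permInv π ++ (permInv τ ++ π'), Z', hπ.inv.append (hτ.inv.append hπ'),
          t₀, s₀, t₁, s₁, hm, hm', (h₁'.perm_comp ht.perm_inv).perm_comp h₁.perm_inv,
          (h₂'.perm_comp hs.perm_inv).perm_comp h₂.perm_inv⟩
      cases Multiset.inj_on_of_nodup_map hS _ hm _ hm₂ rfl
      have h₅ := (h₃.perm_comp h₁).perm_comp ht
      have h₆ := (h₄.perm_comp h₂).perm_comp hs
      obtain rfl := hred W t₃ s₃ Z' t₁ s₁ _ hm₃ hm' (h₅.perm_comp h₁'.perm_inv)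
        (h₆.perm_comp h₂'.perm_inv)
      cases Multiset.inj_on_of_nodup_map hS' _ hm₃ _ hm' rfl
      rw [substTerm_susp, hW, permTerm_susp]
      refine .susp fun a ha => ?_
      by_contra hne
      rw [← permAtom_append] at hne
      refine ha (Finset.mem_coe.2 ((hΓ' _ _).2 ⟨_, _, hm', ?_, h₅.nFresh_of_perm_ne h₁' hne,
        h₆.nFresh_of_perm_ne h₂' hne⟩))
      by_contra haA
      exact hne (by rw [(hτ.append (hπ.append hρ)).permAtom_eq haA, hπ'.permAtom_eq haA])
  | atom a =>
    obtain ht | _ | _ | _ := ht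
    obtain hs | _ | _ | _ := hs
    subst ht hs
    cases h' with
    | leaf h' => exact absurd h'.1 not_solCond_atom
    | atom => rw [substTerm_atom]; exact .atom rfl
  | @app f rs ts ss hl₁ hl₂ _ ih =>
    obtain _ | _ | ⟨hlt, ht⟩ | _ := ht
    obtain _ | _ | ⟨hls, hs⟩ | _ := hs
    cases h' with
    | leaf h' => exact absurd h'.1 (not_solCond_app (hlt.symm.trans (hl₂.trans hls)))
    | @app _ rs' ts' ss' hl₁' hl₂' h' =>
      rw [substTerm_app]
      refine .app (by simp [hl₁, hl₁', hlt]) fun i r r' hr hr' => ?_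
      rw [List.getElem?_map, Option.map_eq_some_iff] at hr
      obtain ⟨r, hr, rfl⟩ := hr
      have hi₁ : i < ts.length := hl₁ ▸ (List.getElem?_eq_some_iff.1 hr).1
      have hi₂ : i < ss.length := hl₂ ▸ hi₁
      have hi₃ := hlt ▸ hi₁
      have hi₄ := hls ▸ hi₂
      exact ih i r _ _ hr (List.getElem?_eq_getElem hi₁) (List.getElem?_eq_getElem hi₂)
        (h' i r' _ _ hr' (List.getElem?_eq_getElem hi₃) (List.getElem?_eq_getElem hi₄)) hτ
        (ht i _ _ (List.getElem?_eq_getElem hi₁) (List.getElem?_eq_getElem hi₃))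
        (hs i _ _ (List.getElem?_eq_getElem hi₂) (List.getElem?_eq_getElem hi₄))
  | @abs a b c r t s hc hct hcs _ ih =>
    have hct' := ht.nFresh_perm hct
    have hcs' := hs.nFresh_perm hcs
    have hτc := hτ.permAtom_mem hc
    obtain ⟨a', t', rfl⟩ : ∃ a' t₁, t' = .abs a' t₁ := by cases ht; exact ⟨_, _, rfl⟩
    obtain ⟨b', s', rfl⟩ : ∃ b' s₁, s' = .abs b' s₁ := by cases hs; exact ⟨_, _, rfl⟩
    cases h' with
    | leaf h' => exact absurd h'.1 (not_solCond_abs hτc hct' hcs')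
    | @abs _ _ c' r' _ _ hc' hdt hds h' =>
      rw [substTerm_abs]
      refine .abs ?_
      have key := ih h' (permBased_cons.2 ⟨hτc, hc', hτ⟩) (ht.concretion hct hdt)
        (hs.concretion hcs hds)
      by_cases hcc : permAtom τ c = c'
      · refine key.mono ?_
        rintro x _ rfl
        subst hcc
        simp only [permAtom, swapAtom, bindRel]
        by_cases hx : x = c
        · exact .inl ⟨hx, by simp [hx]⟩
        · have hne : permAtom τ x ≠ permAtom τ c := fun e => hx (permAtom_injective τ e)
          exact .inr ⟨hx, by simp [hne], by simp [hne]⟩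
      · refine (key.restrict_right (h'.nFresh hΓ' hτc (nFresh_swap_of_abs hcc hct' hdt)
          (nFresh_swap_of_abs hcc hcs' hds))).mono ?_
        rintro x _ ⟨rfl, hy⟩
        simp only [permAtom, swapAtom, bindRel] at hy ⊢
        by_cases hx : x = c
        · exact .inl ⟨hx, by simp [hx]⟩
        · have hne : permAtom τ x ≠ permAtom τ c := fun e => hx (permAtom_injective τ e)
          by_cases hx' : permAtom τ x = c'
          · simp [hx'] at hy
          · exact .inr ⟨hx, by simp [hne, hx'], by simp [hne, hx']⟩

theorem NInvariant.le {A : Finset Atom} {Δ : FCtx} {X : Var} {t s : NTerm} {st st' : NState}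
    (h : NInvariant A Δ X t s st) (h' : NInvariant A Δ X t s st')
    (hP : st.P = 0) (hP' : st'.P = 0) (hmax : ∀ st'', ¬ NStep A Δ st' st'') :
    TIC.Le (st.Γ, st.σ X) (st'.Γ, st'.σ X) := by
  have hS : (st.S.map Prod.fst).Nodup := by simpa [hP] using h.nodup
  have hS' : (st'.S.map Prod.fst).Nodup := by simpa [hP'] using h'.nodup
  have hleaf : ∀ S π Z t s, StateLeaf A Δ 0 S π Z t s → StoreLeaf A Δ S π Z t s := by
    rintro S π Z t s (⟨-, h⟩ | h)
    · exact absurd h (Multiset.notMem_zero _)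
    · exact h
  have hr := h.generalizes.mono (hP ▸ hleaf st.S)
  have hr' := h'.generalizes.mono (hP' ▸ hleaf st'.S)
  have hex : ∀ Z, ∃ u : NTerm,
      (∃ ρ Z', u = .susp ρ Z' ∧ StoreMatch A Δ st.S st'.S Z ρ Z') ∨
      (u = .app 0 [] ∧ ¬ ∃ ρ Z', StoreMatch A Δ st.S st'.S Z ρ Z') := by
    intro Z
    by_cases hZ : ∃ ρ Z', StoreMatch A Δ st.S st'.S Z ρ Z'
    · obtain ⟨ρ, Z', hm⟩ := hZ
      exact ⟨_, .inl ⟨ρ, Z', rfl, hm⟩⟩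
    · exact ⟨_, .inr ⟨rfl, hZ⟩⟩
  choose σ hσ using hex
  refine ⟨σ, ?_, ?_, ?_⟩
  · intro a Z _
    rcases hσ Z with ⟨ρ, Z', e, -⟩ | ⟨e, -⟩ <;> simp [e, FAnoSusp]
  · rintro ⟨a, Z⟩ haZ
    rcases hσ Z with ⟨ρ, Z', e, hρ, t₁, s₁, t₂, s₂, hm₁, hm₂, h₁, h₂⟩ | ⟨e, -⟩
    · obtain ⟨t₀, s₀, hm, ha, hat, has⟩ := (h.ctx a Z).1 haZ
      cases Multiset.inj_on_of_nodup_map hS _ hm _ hm₁ rfl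
      simp only [e]
      exact .susp (Finset.mem_coe.2 ((h'.ctx _ _).2 ⟨t₂, s₂, hm₂, hρ.inv.permAtom_mem ha,
        h₁.perm_inv.nFresh_perm hat, h₂.perm_inv.nFresh_perm has⟩))
    · simp only [e]
      exact .app (by simp)
  · refine nAlpha_iff_alphaVia.2 (hr.alphaVia_substTerm hS hS' h'.ctx
      (storeReduced_of_maximal hmax) (fun Z hZ => ?_) hr' (permBased_nil A)
      (AlphaVia.refl (fun _ => rfl) t) (AlphaVia.refl (fun _ => rfl) s))
    rcases hσ Z with h | h
    · exact h
    · exact absurd hZ h.2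

theorem NInvariant.of_transGen {A : Finset Atom} {Δ : FCtx} {X : Var} {t s : NTerm}
    {st st' : NState} (h : NInvariant A Δ X t s st)
    (hst : Relation.TransGen (NStep A Δ) st st') : NInvariant A Δ X t s st' := by
  induction hst with
  | single hst => exact h.step hst
  | tail _ hst ih => exact ih.step hst

/-- uniqueness modulo `≃` for 𝔑: any two maximal derivations from
`{X : t ≜ s}; ∅; ∅; ε` compute equi-general results. -/
theorem nau_uniqueness (A : Finset Atom) (Δ : FCtx) (t s : NTerm) (X : Var)
    (ht : termBased t A) (hs : termBased s A) (hΔ : ctxBased Δ A)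
    (st₁ st₂ : NState)
    (h1 : Relation.TransGen (NStep A Δ) (initNState X t s Δ) st₁)
    (h2 : Relation.TransGen (NStep A Δ) (initNState X t s Δ) st₂)
    (hP1 : st₁.P = 0) (hP2 : st₂.P = 0)
    (hmax1 : ∀ st, ¬ NStep A Δ st₁ st) (hmax2 : ∀ st, ¬ NStep A Δ st₂ st) :
    TIC.Equiv (st₁.Γ, st₁.σ X) (st₂.Γ, st₂.σ X) := by
  have i₁ := (nInvariant_init (Δ := Δ) (X := X) ht hs).of_transGen h1
  have i₂ := (nInvariant_init (Δ := Δ) (X := X) ht hs).of_transGen h2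
  exact ⟨i₁.le i₂ hP1 hP2 hmax2, i₂.le i₁ hP2 hP1 hmax1⟩
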